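/- For p an odd prime and m ≥ 2, the dimension of any finite-dimensional irreducible complex representation of SL₂(ℤ/p^mℤ) divides the group order p^{3m−2}(p²−1) and is at most p^m(1+1/p). -/

import Mathlib

open Module

namespace Module.End

variable {V : Type*} [AddCommGroup V] [Module ℂ V]

theorem isSemisimple_of_pow_eq_one {T : End ℂ V} {n : ℕ} (hn : n ≠ 0) (hT : T ^ n = 1) :
    T.IsSemisimple := by
  refine isSemisimple_of_squarefree_aeval_eq_zero (p := Polynomial.X ^ n - 1)
    (Polynomial.X_pow_sub_one_separable_iff.2 (by exact_mod_cast hn)).squarefree ?_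
  simp [hT]

theorem pow_apply_of_apply_eq_smul {T : End ℂ V} {μ : ℂ} {v : V} (h : T v = μ • v) (n : ℕ) :
    (T ^ n) v = μ ^ n • v := by
  induction n with
  | zero => simp
  | succ n ih => rw [pow_succ', mul_apply, ih, map_smul, h, smul_smul, pow_succ]

theorem pow_eq_one_of_apply_eq_smul {T : End ℂ V} {n : ℕ} {μ : ℂ} {v : V} (hT : (T ^ n) v = v)
    (h : T v = μ • v) (hv : v ≠ 0) : μ ^ n = 1 := by
  rw [pow_apply_of_apply_eq_smul h] at hT
  have : (μ ^ n - 1) • v = 0 := by rw [sub_smul, hT, one_smul, sub_self]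
  exact sub_eq_zero.1 ((smul_eq_zero.1 this).resolve_right hv)

theorem exists_eq_of_hasEigenvalue_of_span_eq_top {ι : Type*} {T : End ℂ V} {f : ι → V}
    {e : ι → ℂ} (hf : Submodule.span ℂ (Set.range f) = ⊤) (hT : ∀ i, T (f i) = e i • f i)
    {μ : ℂ} (hμ : T.HasEigenvalue μ) : ∃ i, e i = μ := by
  by_contra! hne
  have hle : Submodule.span ℂ (Set.range f) ≤ ⨆ ν, ⨆ (_ : ν ≠ μ), T.eigenspace ν := by
    rw [Submodule.span_le]
    rintro _ ⟨i, rfl⟩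
    exact Submodule.mem_iSup_of_mem (e i) (Submodule.mem_iSup_of_mem (hne i)
      (mem_eigenspace_iff.2 (hT i)))
  rw [hf, top_le_iff] at hle
  have := T.eigenspaces_iSupIndep μ
  rw [hle, disjoint_top] at this
  exact hμ this

variable [FiniteDimensional ℂ V]

theorem exists_apply_eq_smul_mem (T : End ℂ V) {W : Submodule ℂ V} (hW : ∀ x ∈ W, T x ∈ W)
    (hne : W ≠ ⊥) : ∃ v ∈ W, v ≠ 0 ∧ ∃ μ : ℂ, T v = μ • v := by
  have : Nontrivial W := Submodule.nontrivial_iff_ne_bot.2 hne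
  obtain ⟨μ, hμ⟩ := exists_eigenvalue (T.restrict hW)
  obtain ⟨v, hv, hv0⟩ := hμ.exists_hasEigenvector
  refine ⟨v, v.2, by simpa using hv0, μ, ?_⟩
  simpa using congrArg Subtype.val (mem_eigenspace_iff.1 hv)

theorem apply_eq_self_of_forall_eigenvalue_eq_one {T : End ℂ V} {n : ℕ} (hn : n ≠ 0)
    (hT : T ^ n = 1) {W : Submodule ℂ V} (hW : ∀ x ∈ W, T x ∈ W)
    (h : ∀ v ∈ W, v ≠ 0 → ∀ μ : ℂ, T v = μ • v → μ = 1) {v : V} (hv : v ∈ W) : T v = v := by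
  have hpow : (T.restrict hW) ^ n = 1 := by
    ext x
    rw [Module.End.pow_restrict n hW]
    simp [hT]
  have htop := (isSemisimple_of_pow_eq_one hn hpow).iSup_eigenspace_eq_top
  have hle : ⨆ μ, eigenspace (T.restrict hW) μ ≤ eigenspace (T.restrict hW) 1 := by
    refine iSup_le fun μ x hx => ?_
    by_cases hx0 : x = 0
    · simp [hx0]
    · have := h x x.2 (by simpa using hx0) μ
        (by simpa using congrArg Subtype.val (mem_eigenspace_iff.1 hx))
      rwa [this] at hx
  have hmem : (⟨v, hv⟩ : W) ∈ eigenspace (T.restrict hW) 1 := hle (htop ▸ Submodule.mem_top)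
  simpa using congrArg Subtype.val (mem_eigenspace_iff.1 hmem)

theorem finrank_le_finrank_eigenspace_pow_add_card {T : End ℂ V} {n k : ℕ} (hn : n ≠ 0)
    (hT : T ^ n = 1) (M : Finset ℂ) (hM : ∀ μ, T.HasEigenvalue μ → μ ^ k ≠ 1 → μ ∈ M)
    (h1 : ∀ μ ∈ M, finrank ℂ (T.eigenspace μ) ≤ 1) :
    finrank ℂ V ≤ finrank ℂ ((T ^ k).eigenspace 1) + M.card := by
  have htop := (isSemisimple_of_pow_eq_one hn hT).iSup_eigenspace_eq_top
  have hle : ⨆ μ, T.eigenspace μ ≤ (T ^ k).eigenspace 1 ⊔ M.sup T.eigenspace := by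
    refine iSup_le fun μ => ?_
    by_cases hμ : T.HasEigenvalue μ
    · by_cases hk : μ ^ k = 1
      · refine le_sup_of_le_left fun x hx => ?_
        rw [mem_eigenspace_iff] at hx ⊢
        rw [pow_apply_of_apply_eq_smul hx, hk]
      · exact le_sup_of_le_right (Finset.le_sup (f := T.eigenspace) (hM μ hμ hk))
    · have : T.eigenspace μ = ⊥ := by simpa [hasEigenvalue_iff] using hμ
      simp [this]
  have hsum : ∀ M : Finset ℂ, (∀ μ ∈ M, finrank ℂ (T.eigenspace μ) ≤ 1) →
      finrank ℂ (M.sup T.eigenspace : Submodule ℂ V) ≤ M.card := by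
    classical
    intro M
    induction M using Finset.induction_on with
    | empty => simp
    | insert a s ha ih =>
      intro h
      rw [Finset.sup_insert, Finset.card_insert_of_notMem ha, add_comm]
      exact (Submodule.finrank_add_le_finrank_add_finrank _ _).trans
        (add_le_add (h a (by simp)) (ih fun μ hμ => h μ (by simp [hμ])))
  rw [← finrank_top ℂ V, ← htop]
  exact (Submodule.finrank_mono hle).trans
    ((Submodule.finrank_add_le_finrank_add_finrank _ _).trans (by gcongr; exact hsum M h1))

end Module.End

theorem Representation.apply_ne_zero {k G V : Type*} [CommRing k] [Group G] [AddCommGroup V]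
    [Module k V] (ρ : Representation k G V) (g : G) {v : V} (hv : v ≠ 0) : ρ g v ≠ 0 := fun h =>
  hv <| by rw [← End.one_apply (R := k) v, ← map_one ρ, ← inv_mul_cancel g, map_mul,
    End.mul_apply, h, map_zero]

namespace Representation.IsIrreducible

variable {G V : Type*} [Group G] [AddCommGroup V] [Module ℂ V]

theorem of_forall_submodule [Nontrivial V] {ρ : Representation ℂ G V}
    (h : ∀ U : Submodule ℂ V, (∀ g, ∀ x ∈ U, ρ g x ∈ U) → U = ⊥ ∨ U = ⊤) :
    ρ.IsIrreducible where
  exists_pair_ne := ⟨⊥, ⊤, fun h => bot_ne_top (congrArg Subrepresentation.toSubmodule h)⟩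
  eq_bot_or_eq_top U := (h U.toSubmodule fun g _ hx => U.apply_mem_toSubmodule g hx).imp
    (fun h => Subrepresentation.toSubmodule_injective h)
    (fun h => Subrepresentation.toSubmodule_injective h)

theorem nontrivial (ρ : Representation ℂ G V) [hρ : ρ.IsIrreducible] : Nontrivial V := by
  by_contra hV
  rw [not_nontrivial_iff_subsingleton] at hV
  exact bot_ne_top (α := Subrepresentation ρ)
    (Subrepresentation.toSubmodule_injective (Subsingleton.elim _ _))

theorem submodule_eq_top (ρ : Representation ℂ G V) [ρ.IsIrreducible] (U : Submodule ℂ V)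
    (hU : ∀ g, ∀ x ∈ U, ρ g x ∈ U) {v : V} (hv : v ∈ U) (hv0 : v ≠ 0) : U = ⊤ := by
  rcases eq_bot_or_eq_top (⟨U, fun g x hx => hU g x hx⟩ : Subrepresentation ρ) with h | h
  · have : U = ⊥ := congrArg Subrepresentation.toSubmodule h
    exact absurd (by simpa [this] using hv) hv0
  · exact congrArg Subrepresentation.toSubmodule h

theorem span_orbit_eq_top (ρ : Representation ℂ G V) [ρ.IsIrreducible] {v : V} (hv : v ≠ 0) :
    Submodule.span ℂ (Set.range fun g => ρ g v) = ⊤ := by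
  refine submodule_eq_top ρ _ (fun g x hx => ?_)
    (Submodule.subset_span (Set.mem_range.2 ⟨1, by simp⟩)) hv
  induction hx using Submodule.span_induction with
  | mem x hx =>
    obtain ⟨h, rfl⟩ := hx
    exact Submodule.subset_span ⟨g * h, by simp⟩
  | zero => simp
  | add x y _ _ hx hy => simpa using add_mem hx hy
  | smul c x _ hx => simpa using Submodule.smul_mem _ c hx

theorem exists_eq_smul_of_commute [FiniteDimensional ℂ V] (ρ : Representation ℂ G V)
    [ρ.IsIrreducible] (T : End ℂ V) (hT : ∀ g, ρ g * T = T * ρ g) :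
    ∃ c : ℂ, T = c • 1 := by
  have := nontrivial ρ
  obtain ⟨c, hc⟩ := End.exists_eigenvalue T
  obtain ⟨v, hv, hv0⟩ := hc.exists_hasEigenvector
  have := submodule_eq_top ρ (End.eigenspace T c) (fun g x hx => ?_) hv hv0
  · refine ⟨c, LinearMap.ext fun x => ?_⟩
    simpa using End.mem_eigenspace_iff.1 (this ▸ Submodule.mem_top : x ∈ End.eigenspace T c)
  · rw [End.mem_eigenspace_iff] at hx ⊢
    rw [← End.mul_apply, ← hT, End.mul_apply, hx, map_smul]

theorem isIntegral_character [Finite G] [FiniteDimensional ℂ V] (ρ : Representation ℂ G V)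
    (g : G) : IsIntegral ℤ (ρ.character g) := by
  let b := Module.finBasis ℂ V
  rw [Representation.character, LinearMap.trace_eq_matrix_trace ℂ b,
    Matrix.trace_eq_sum_roots_charpoly]
  refine IsIntegral.multiset_sum fun μ hμ => ?_
  rw [LinearMap.charpoly_toMatrix, Polynomial.mem_roots (LinearMap.charpoly_monic _).ne_zero,
    ← End.hasEigenvalue_iff_isRoot_charpoly] at hμ
  obtain ⟨v, hv⟩ := hμ.exists_hasEigenvector
  have h1 : μ ^ Nat.card G = 1 :=
    End.pow_eq_one_of_apply_eq_smul (by rw [← map_pow, pow_card_eq_one', map_one, End.one_apply])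
      hv.apply_eq_smul hv.2
  exact IsIntegral.of_pow Nat.card_pos (h1 ▸ isIntegral_one)

/-- The dimension of an irreducible complex representation of a finite group divides the order
of the group. -/
theorem finrank_dvd_card [Finite G] [FiniteDimensional ℂ V] (ρ : Representation ℂ G V)
    [ρ.IsIrreducible] : finrank ℂ V ∣ Nat.card G := by
  classical
  have := nontrivial ρ
  have := Fintype.ofFinite G
  have hd : (finrank ℂ V : ℂ) ≠ 0 := by exact_mod_cast finrank_pos.ne'
  have hG : (Nat.card G : ℂ) ≠ 0 := by exact_mod_cast Nat.card_pos.ne'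
  let A := integralClosure ℤ ℂ
  let z : MonoidAlgebra A G :=
    ∑ g : G, MonoidAlgebra.single g ⟨ρ.character g⁻¹, isIntegral_character ρ g⁻¹⟩
  let φ : MonoidAlgebra A G →ₐ[A] End ℂ V := MonoidAlgebra.lift A (End ℂ V) G ρ
  have hφ : φ z = ∑ g : G, ρ.character g⁻¹ • ρ g := by
    simp only [z, φ, map_sum, MonoidAlgebra.lift_single]
    rfl
  have hcomm : ∀ h, ρ h * φ z = φ z * ρ h := fun h => by
    rw [hφ, Finset.mul_sum, Finset.sum_mul]
    refine Fintype.sum_equiv (MulAut.conj h).toEquiv _ _ fun g => ?_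
    have : ρ.character (h * g * h⁻¹)⁻¹ = ρ.character g⁻¹ := by
      rw [← ρ.char_conj g⁻¹ h]
      congr 1
      group
    simp only [MulEquiv.toEquiv_eq_coe, MulEquiv.coe_toEquiv, MulAut.conj_apply, this]
    rw [mul_smul_comm, smul_mul_assoc, ← map_mul, ← map_mul]
    congr 2
    group
  obtain ⟨c, hc⟩ := exists_eq_smul_of_commute ρ (φ z) hcomm
  have htr : c * finrank ℂ V = Nat.card G := by
    have h1 : LinearMap.trace ℂ V (φ z) = c * finrank ℂ V := by
      rw [hc, map_smul, LinearMap.trace_one, smul_eq_mul]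
    let _ : Invertible (Nat.card G : ℂ) := invertibleOfNonzero hG
    have h2 := ρ.char_orthonormal ρ
    rw [if_pos ⟨Equiv.refl ρ⟩, inv_mul_eq_one₀ hG] at h2
    rw [← h1, h2, hφ, map_sum]
    refine Finset.sum_congr rfl fun g _ => ?_
    rw [map_smul, smul_eq_mul, mul_comm]
    rfl
  have hint : IsIntegral A (φ z) := (IsIntegral.of_finite A z).map φ
  have hcint : IsIntegral A c := by
    have hinj : Function.Injective (algebraMap ℂ (End ℂ V)) :=
      FaithfulSMul.algebraMap_injective ℂ (End ℂ V)
    rw [← isIntegral_algHom_iff (IsScalarTower.toAlgHom A ℂ (End ℂ V)) hinj]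
    simpa [Algebra.algebraMap_eq_smul_one, hc] using hint
  have hcz : IsIntegral ℤ c := isIntegral_trans c hcint
  have hcq : c = algebraMap ℚ ℂ ((Nat.card G : ℚ) / finrank ℂ V) := by
    rw [eq_div_iff hd |>.2 htr]
    simp
  rw [hcq, isIntegral_algebraMap_iff (algebraMap ℚ ℂ).injective,
    IsIntegrallyClosed.isIntegral_iff] at hcz
  obtain ⟨k, hk⟩ := hcz
  have hdq : (finrank ℂ V : ℚ) ≠ 0 := by exact_mod_cast finrank_pos.ne'
  rw [eq_div_iff hdq] at hk
  have hk' : k * (finrank ℂ V : ℤ) = Nat.card G := by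
    have : (k : ℚ) * finrank ℂ V = Nat.card G := by simpa using hk
    exact_mod_cast this
  exact Int.natCast_dvd_natCast.1 ⟨k, by rw [mul_comm, hk']⟩

end Representation.IsIrreducible

theorem IsPrimitiveRoot.natCast_eq_of_pow_eq {M : Type*} [CommMonoid M] {ζ : M} {n a b : ℕ}
    (h : IsPrimitiveRoot ζ n) (hn : n ≠ 0) (hab : ζ ^ a = ζ ^ b) : (a : ZMod n) = b := by
  obtain ⟨u, rfl⟩ := h.isUnit hn
  have hu := IsPrimitiveRoot.coe_units_iff.1 h
  rw [ZMod.natCast_eq_natCast_iff, hu.eq_orderOf, ← pow_eq_pow_iff_modEq]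
  exact Units.ext (by simpa using hab)

namespace ZMod

variable {p m : ℕ}

theorem dvd_of_forall_mul_eq_zero {n : ℕ} [NeZero n] {c z : ZMod n}
    (h : ∀ x, x * c = 0 → x * z = 0) : c ∣ z := by
  have hn : 0 < n := Nat.pos_of_neZero n
  obtain ⟨l, hl⟩ := Nat.gcd_dvd_right c.val n
  obtain ⟨k, hk⟩ := Nat.gcd_dvd_left c.val n
  have hl0 : 0 < l := Nat.pos_of_ne_zero fun h0 => by simp [h0] at hl; omega
  have hc : c ∣ ((Nat.gcd c.val n : ℕ) : ZMod n) := by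
    refine ⟨(Nat.gcdA c.val n : ZMod n), ?_⟩
    have := congrArg (Int.cast (R := ZMod n)) (Nat.gcd_eq_gcd_ab c.val n)
    simpa using this
  have hlc : (l : ZMod n) * c = 0 := by
    rw [← ZMod.natCast_zmod_val c, hk, ← Nat.cast_mul, ZMod.natCast_eq_zero_iff]
    exact ⟨k, by rw [← mul_assoc, mul_comm l, ← hl]⟩
  have hlz := h l hlc
  rw [← ZMod.natCast_zmod_val z, ← Nat.cast_mul, ZMod.natCast_eq_zero_iff] at hlz
  have hdvd : Nat.gcd c.val n ∣ z.val := by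
    have : l * Nat.gcd c.val n ∣ l * z.val := by rwa [mul_comm l, ← hl]
    exact (Nat.mul_dvd_mul_iff_left hl0).1 this
  refine hc.trans ?_
  rw [← ZMod.natCast_zmod_val z]
  exact Nat.cast_dvd_cast hdvd

theorem isUnit_iff_not_dvd_val (hp : p.Prime) (hm : m ≠ 0) (x : ZMod (p ^ m)) :
    IsUnit x ↔ ¬ p ∣ x.val := by
  have : NeZero (p ^ m) := ⟨pow_ne_zero _ hp.ne_zero⟩
  conv_lhs => rw [← ZMod.natCast_zmod_val x]
  rw [ZMod.isUnit_iff_coprime, Nat.coprime_pow_right_iff (Nat.pos_of_ne_zero hm), Nat.coprime_comm,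
    hp.coprime_iff_not_dvd]

theorem exists_eq_mul_of_not_isUnit (hp : p.Prime) (hm : m ≠ 0) {x : ZMod (p ^ m)}
    (hx : ¬ IsUnit x) : ∃ j < p ^ (m - 1), x = (p : ZMod (p ^ m)) * (j : ℕ) := by
  have : NeZero (p ^ m) := ⟨pow_ne_zero _ hp.ne_zero⟩
  rw [isUnit_iff_not_dvd_val hp hm, not_not] at hx
  obtain ⟨j, hj⟩ := hx
  refine ⟨j, ?_, by rw [← Nat.cast_mul, ← hj, ZMod.natCast_zmod_val]⟩
  have h1 := ZMod.val_lt x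
  rw [hj, ← Nat.sub_add_cancel (Nat.one_le_iff_ne_zero.2 hm), pow_succ'] at h1
  exact Nat.lt_of_mul_lt_mul_left h1

theorem isUnit_or_isUnit_of_mul_sub_mul_eq_one (hp : p.Prime) (hm : m ≠ 0) {a b c d : ZMod (p ^ m)}
    (h : a * d - b * c = 1) : IsUnit a ∨ IsUnit c := by
  by_contra! hac
  obtain ⟨i, -, hi⟩ := exists_eq_mul_of_not_isUnit hp hm hac.1
  obtain ⟨j, -, hj⟩ := exists_eq_mul_of_not_isUnit hp hm hac.2
  have h1 : IsUnit (p : ZMod (p ^ m)) :=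
    IsUnit.of_mul_eq_one ((i : ℕ) * d - b * (j : ℕ)) (by rw [← h, hi, hj]; ring)
  rw [ZMod.isUnit_iff_coprime, Nat.coprime_pow_right_iff (Nat.pos_of_ne_zero hm),
    Nat.coprime_self] at h1
  exact hp.one_lt.ne' h1

theorem natCast_pow_mul_self_eq_zero {m : ℕ} (hm : 2 ≤ m) :
    ((p : ZMod (p ^ m)) ^ (m - 1)) * (p : ZMod (p ^ m)) ^ (m - 1) = 0 := by
  rw [← pow_add, ← Nat.cast_pow, ZMod.natCast_eq_zero_iff]
  exact pow_dvd_pow _ (by lia)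

end ZMod

namespace Matrix.SpecialLinearGroup

section CommRing

variable {R : Type*} [CommRing R]

/-- The upper unipotent matrix with off-diagonal entry `x`. -/
def upper (x : R) : SpecialLinearGroup (Fin 2) R := ⟨!![1, x; 0, 1], by simp [det_fin_two_of]⟩

/-- The lower unipotent matrix with off-diagonal entry `x`. -/
def lower (x : R) : SpecialLinearGroup (Fin 2) R := ⟨!![1, 0; x, 1], by simp [det_fin_two_of]⟩

/-- The diagonal matrix with entries `t` and `t⁻¹`. -/
def torus (t : Rˣ) : SpecialLinearGroup (Fin 2) R :=
  ⟨!![(t : R), 0; 0, ((t⁻¹ : Rˣ) : R)], by simp [det_fin_two_of]⟩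

/-- The Weyl element. -/
def weyl : SpecialLinearGroup (Fin 2) R := ⟨!![0, 1; -1, 0], by simp [det_fin_two_of]⟩

/-- The reflection in the antidiagonal, an anti-automorphism fixing the upper unipotent
matrices. -/
def antiTranspose (g : SpecialLinearGroup (Fin 2) R) : SpecialLinearGroup (Fin 2) R :=
  ⟨!![g 1 1, g 0 1; g 1 0, g 0 0], by
    have := g.det_coe
    rw [det_fin_two] at this
    rw [det_fin_two_of]
    linear_combination this⟩

@[simp] theorem coe_upper (x : R) : (upper x : Matrix (Fin 2) (Fin 2) R) = !![1, x; 0, 1] := rfl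

@[simp] theorem coe_lower (x : R) : (lower x : Matrix (Fin 2) (Fin 2) R) = !![1, 0; x, 1] := rfl

@[simp] theorem coe_torus (t : Rˣ) :
    (torus t : Matrix (Fin 2) (Fin 2) R) = !![(t : R), 0; 0, ((t⁻¹ : Rˣ) : R)] := rfl

@[simp] theorem coe_weyl : (weyl : SpecialLinearGroup (Fin 2) R).1 = !![0, 1; -1, 0] := rfl

@[simp] theorem coe_antiTranspose (g : SpecialLinearGroup (Fin 2) R) :
    (antiTranspose g : Matrix (Fin 2) (Fin 2) R) = !![g 1 1, g 0 1; g 1 0, g 0 0] := rfl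

theorem det_eq_one_fin_two (g : SpecialLinearGroup (Fin 2) R) :
    g 0 0 * g 1 1 - g 0 1 * g 1 0 = 1 := by
  rw [← det_fin_two]
  exact g.det_coe

theorem mul_entry (g h : SpecialLinearGroup (Fin 2) R) (i j : Fin 2) :
    (g * h) i j = g i 0 * h 0 j + g i 1 * h 1 j := by
  simp only [coe_mul, mul_apply, Fin.sum_univ_two]

theorem ext_fin_two {g h : SpecialLinearGroup (Fin 2) R} (h00 : g 0 0 = h 0 0)
    (h01 : g 0 1 = h 0 1) (h10 : g 1 0 = h 1 0) (h11 : g 1 1 = h 1 1) : g = h := by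
  ext i j
  fin_cases i <;> fin_cases j <;> assumption

theorem upper_add (x y : R) : upper (x + y) = upper x * upper y := by
  apply ext_fin_two <;> simp [add_comm]

theorem lower_add (x y : R) : lower (x + y) = lower x * lower y := by
  apply ext_fin_two <;> simp

@[simp] theorem upper_zero : upper (0 : R) = 1 := by
  apply ext_fin_two <;> simp

@[simp] theorem lower_zero : lower (0 : R) = 1 := by
  apply ext_fin_two <;> simp

theorem upper_pow (x : R) (n : ℕ) : upper x ^ n = upper (n * x) := by
  induction n with
  | zero => simp
  | succ n ih => rw [pow_succ, ih, ← upper_add]; congr 1; push_cast; ring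

theorem lower_pow (x : R) (n : ℕ) : lower x ^ n = lower (n * x) := by
  induction n with
  | zero => simp
  | succ n ih => rw [pow_succ, ih, ← lower_add]; congr 1; push_cast; ring

theorem torus_mul (s t : Rˣ) : torus (s * t) = torus s * torus t := by
  apply ext_fin_two <;> simp [mul_comm]

@[simp] theorem torus_one : torus (1 : Rˣ) = 1 := by
  apply ext_fin_two <;> simp

theorem torus_pow (u : Rˣ) (n : ℕ) : torus (u ^ n) = torus u ^ n := by
  induction n with
  | zero => simp
  | succ n ih => rw [pow_succ, torus_mul, ih, pow_succ]

theorem torus_mul_upper (t : Rˣ) (x : R) :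
    torus t * upper x = upper (t * t * x) * torus t := by
  apply ext_fin_two <;> simp [mul_assoc, mul_comm x]

theorem antiTranspose_mul (g h : SpecialLinearGroup (Fin 2) R) :
    antiTranspose (g * h) = antiTranspose h * antiTranspose g := by
  apply ext_fin_two <;> simp [mul_entry] <;> ring

theorem antiTranspose_upper (x : R) : antiTranspose (upper x) = upper x := by
  apply ext_fin_two <;> simp

end CommRing

section Whittaker

variable {n : ℕ} [NeZero n] {V : Type*} [AddCommGroup V] [Module ℂ V]

/-- The unnormalised projection to the `ψ`-eigenspace of the upper unipotent subgroup. -/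
noncomputable def whittaker (ρ : Representation ℂ (SpecialLinearGroup (Fin 2) (ZMod n)) V)
    (ψ : AddChar (ZMod n) ℂ) : End ℂ V :=
  ∑ x : ZMod n, ψ (-x) • ρ (upper x)

variable (ρ : Representation ℂ (SpecialLinearGroup (Fin 2) (ZMod n)) V) (ψ : AddChar (ZMod n) ℂ)

theorem whittaker_mul_upper (y : ZMod n) :
    whittaker ρ ψ * ρ (upper y) = ψ y • whittaker ρ ψ := by
  rw [whittaker, Finset.sum_mul, Finset.smul_sum]
  refine Fintype.sum_equiv (Equiv.addRight y) _ _ fun x => ?_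
  rw [smul_mul_assoc, ← map_mul, ← upper_add, smul_smul, ← AddChar.map_add_eq_mul]
  simp

theorem upper_mul_whittaker (y : ZMod n) :
    ρ (upper y) * whittaker ρ ψ = ψ y • whittaker ρ ψ := by
  rw [whittaker, Finset.mul_sum, Finset.smul_sum]
  refine Fintype.sum_equiv (Equiv.addLeft y) _ _ fun x => ?_
  rw [mul_smul_comm, ← map_mul, ← upper_add, smul_smul, ← AddChar.map_add_eq_mul]
  simp

theorem whittaker_mul_mul_upper (g : SpecialLinearGroup (Fin 2) (ZMod n)) (x y : ZMod n) :
    whittaker ρ ψ * ρ (upper x * g * upper y) * whittaker ρ ψ =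
      ψ (x + y) • (whittaker ρ ψ * ρ g * whittaker ρ ψ) := by
  rw [map_mul, map_mul, ← mul_assoc, ← mul_assoc, whittaker_mul_upper, mul_assoc,
    upper_mul_whittaker, smul_mul_assoc, smul_mul_assoc, mul_smul_comm, smul_smul,
    AddChar.map_add_eq_mul]

theorem whittaker_mul_antiTranspose_mul (hψ : ψ.IsPrimitive)
    (g : SpecialLinearGroup (Fin 2) (ZMod n)) :
    whittaker ρ ψ * ρ (antiTranspose g) * whittaker ρ ψ =
      whittaker ρ ψ * ρ g * whittaker ρ ψ := by
  have key : ∀ h : SpecialLinearGroup (Fin 2) (ZMod n), (¬ h 1 0 ∣ h 1 1 - h 0 0) →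
      whittaker ρ ψ * ρ h * whittaker ρ ψ = 0 := fun h hh => by
    obtain ⟨x, hxc, hxz⟩ : ∃ x, x * h 1 0 = 0 ∧ x * (h 1 1 - h 0 0) ≠ 0 := by
      by_contra! hcon
      exact hh (ZMod.dvd_of_forall_mul_eq_zero hcon)
    obtain ⟨r, hr⟩ : ∃ r, ψ (r * (x * (h 0 0 - h 1 1))) ≠ 1 := by
      have hne : x * (h 0 0 - h 1 1) ≠ 0 := fun h0 => hxz (by linear_combination -h0)
      by_contra! hcon
      exact hψ hne (DFunLike.ext _ _ fun r => by simpa [mul_comm] using hcon r)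
    have hfix : upper (r * x * h 0 0) * h * upper (-(r * x * h 1 1)) = h := by
      have := det_eq_one_fin_two h
      apply ext_fin_two <;> simp [mul_entry]
      · linear_combination r * h 0 0 * hxc
      · linear_combination (-r ^ 2 * x * h 0 0 * h 1 1) * hxc
      · linear_combination (r * h 1 1) * hxc
    have h1 := whittaker_mul_mul_upper ρ ψ h (r * x * h 0 0) (-(r * x * h 1 1))
    rw [hfix] at h1
    have h2 : r * x * h 0 0 + -(r * x * h 1 1) = r * (x * (h 0 0 - h 1 1)) := by ring
    rw [h2] at h1
    have h3 : (1 - ψ (r * (x * (h 0 0 - h 1 1)))) •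
        (whittaker ρ ψ * ρ h * whittaker ρ ψ) = 0 := by
      rw [sub_smul, one_smul, ← h1, sub_self]
    exact (smul_eq_zero.1 h3).resolve_left (sub_ne_zero.2 (Ne.symm hr))
  by_cases hd : g 1 0 ∣ g 1 1 - g 0 0
  · obtain ⟨x, hx⟩ := hd
    have : antiTranspose g = upper x * g * upper (-x) := by
      apply ext_fin_two <;> simp [mul_entry]
      · linear_combination hx
      · linear_combination (-x) * hx
      · linear_combination -hx
    rw [this, whittaker_mul_mul_upper]
    simp
  · rw [key g hd, key]
    intro ⟨x, hx⟩
    simp at hx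
    exact hd ⟨-x, by linear_combination -hx⟩

theorem whittaker_mul_mul_comm (hψ : ψ.IsPrimitive)
    (g h : SpecialLinearGroup (Fin 2) (ZMod n)) :
    whittaker ρ ψ * ρ g * whittaker ρ ψ * ρ h * whittaker ρ ψ =
      whittaker ρ ψ * ρ h * whittaker ρ ψ * ρ g * whittaker ρ ψ := by
  have expand : ∀ a b : SpecialLinearGroup (Fin 2) (ZMod n),
      whittaker ρ ψ * ρ a * whittaker ρ ψ * ρ b * whittaker ρ ψ =
        ∑ x : ZMod n, ψ (-x) • (whittaker ρ ψ * ρ (a * upper x * b) * whittaker ρ ψ) := by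
    intro a b
    have : whittaker ρ ψ * ρ a * whittaker ρ ψ * ρ b * whittaker ρ ψ =
      whittaker ρ ψ * ρ a * (∑ x : ZMod n, ψ (-x) • ρ (upper x)) * ρ b * whittaker ρ ψ := rfl
    rw [this, Finset.mul_sum, Finset.sum_mul, Finset.sum_mul]
    refine Finset.sum_congr rfl fun x _ => ?_
    simp only [mul_smul_comm, smul_mul_assoc, map_mul, mul_assoc]
  have step : ∀ a b : SpecialLinearGroup (Fin 2) (ZMod n),
      whittaker ρ ψ * ρ a * whittaker ρ ψ * ρ b * whittaker ρ ψ =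
        whittaker ρ ψ * ρ (antiTranspose b) * whittaker ρ ψ * ρ (antiTranspose a) *
          whittaker ρ ψ := by
    intro a b
    rw [expand, expand]
    refine Finset.sum_congr rfl fun x _ => ?_
    rw [← whittaker_mul_antiTranspose_mul ρ ψ hψ, antiTranspose_mul, antiTranspose_mul,
      antiTranspose_upper, mul_assoc (antiTranspose b)]
  rw [step, whittaker_mul_antiTranspose_mul ρ ψ hψ, mul_assoc, mul_assoc,
    ← mul_assoc (whittaker ρ ψ) (ρ (antiTranspose g)),
    whittaker_mul_antiTranspose_mul ρ ψ hψ]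
  simp only [mul_assoc]

/-- Multiplicity one for nondegenerate characters of the upper unipotent subgroup. -/
theorem finrank_eigenspace_upper_le_one [FiniteDimensional ℂ V] [ρ.IsIrreducible] {μ : ℂ}
    (hμ : IsPrimitiveRoot μ n) : finrank ℂ (End.eigenspace (ρ (upper 1)) μ) ≤ 1 := by
  by_cases hbot : End.eigenspace (ρ (upper 1)) μ = ⊥
  · rw [hbot, finrank_bot]
    exact zero_le_one
  have hn : (n : ℂ) ≠ 0 := by exact_mod_cast NeZero.ne n
  obtain ⟨ψ, hψ, hψ1⟩ : ∃ ψ : AddChar (ZMod n) ℂ, ψ.IsPrimitive ∧ ∀ x, ψ x = μ ^ x.val :=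
    ⟨_, AddChar.zmodChar_primitive_of_primitive_root n hμ, fun x => AddChar.zmodChar_apply _ x⟩
  set W := End.eigenspace (ρ (upper 1)) μ with hW
  have hone : ψ 1 = μ := by
    rcases Nat.lt_or_ge 1 n with h1 | h1
    · have : Fact (1 < n) := ⟨h1⟩
      simp [hψ1, ZMod.val_one]
    · have : n = 1 := le_antisymm h1 (Nat.pos_of_neZero n)
      subst this
      have : μ = 1 := by simpa using hμ.pow_eq_one
      simp [hψ1, this]
  have hrange : ∀ v, whittaker ρ ψ v ∈ W := fun v => by
    rw [End.mem_eigenspace_iff, ← End.mul_apply, upper_mul_whittaker, hone]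
    rfl
  have hfix : ∀ v ∈ W, whittaker ρ ψ v = (n : ℂ) • v := fun v hv => by
    have h1 : ∀ x : ZMod n, ρ (upper x) v = ψ x • v := fun x => by
      have : upper x = upper 1 ^ x.val := by rw [upper_pow]; simp
      rw [this, map_pow, hψ1]
      exact End.pow_apply_of_apply_eq_smul (End.mem_eigenspace_iff.1 hv) _
    have h2 : ∀ x : ZMod n, ψ (-x) * ψ x = 1 := fun x => by
      rw [← AddChar.map_add_eq_mul]; simp
    simp [whittaker, LinearMap.sum_apply, h1, smul_smul, h2, ← Nat.cast_smul_eq_nsmul ℂ]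
  have hspan : ∀ w : V, w ≠ 0 → ∀ S : Submodule ℂ V,
      (∀ h, whittaker ρ ψ (ρ h w) ∈ S) → W ≤ S := fun w hw S hS v hv => by
    have hall : ∀ x, whittaker ρ ψ x ∈ S := fun x => by
      have hle : Submodule.span ℂ (Set.range fun g => ρ g w) ≤ S.comap (whittaker ρ ψ) :=
        Submodule.span_le.2 (by rintro _ ⟨h, rfl⟩; exact hS h)
      rw [Representation.IsIrreducible.span_orbit_eq_top ρ hw] at hle
      exact hle Submodule.mem_top
    have := S.smul_mem (n : ℂ)⁻¹ (hall v)
    rwa [hfix v hv, smul_smul, inv_mul_cancel₀ hn, one_smul] at this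
  have hscalar : ∀ g, ∃ c : ℂ, ∀ v ∈ W, whittaker ρ ψ (ρ g v) = c • v := fun g => by
    obtain ⟨w, hwW, hw0, c, hc⟩ := End.exists_apply_eq_smul_mem (whittaker ρ ψ * ρ g)
      (W := W) (fun x _ => hrange _) hbot
    refine ⟨c, fun v hv => ?_⟩
    refine End.mem_eigenspace_iff.1
      (hspan w hw0 (End.eigenspace (whittaker ρ ψ * ρ g) c) (fun h => ?_) hv)
    rw [End.mem_eigenspace_iff]
    have h1 := LinearMap.congr_fun (whittaker_mul_mul_comm ρ ψ hψ g h) w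
    simp only [End.mul_apply] at h1 hc ⊢
    rw [hfix w hwW] at h1
    simp only [map_smul, hc] at h1
    exact smul_right_injective V hn h1
  obtain ⟨w, hwW, hw0⟩ := Submodule.exists_mem_ne_zero_of_ne_bot hbot
  have hle : W ≤ Submodule.span ℂ {w} := hspan w hw0 _ fun h => by
    obtain ⟨c, hc⟩ := hscalar h
    rw [hc w hwW]
    exact Submodule.smul_mem _ _ (Submodule.mem_span_singleton_self w)
  exact (Submodule.finrank_mono hle).trans (finrank_span_singleton hw0).le

end Whittaker

section Borel

variable {p m : ℕ} {V : Type*} [AddCommGroup V] [Module ℂ V]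

theorem map_upper_apply_of_fixed {n : ℕ} [NeZero n]
    (ρ : Representation ℂ (SpecialLinearGroup (Fin 2) (ZMod n)) V) {y : ZMod n} {v : V}
    (hv : ρ (upper y) v = v) (x : ZMod n) : ρ (upper (x * y)) v = v := by
  have h1 : upper (x * y) = upper y ^ x.val := by rw [upper_pow, ZMod.natCast_zmod_val]
  have h2 := End.pow_apply_of_apply_eq_smul (T := ρ (upper y)) (μ := 1) (by simpa using hv) x.val
  rw [h1, map_pow]
  simpa using h2

/-- An irreducible representation with a nonzero vector fixed by the upper unipotent subgroup
has dimension at most the index of the Borel subgroup. -/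
theorem finrank_le_of_upper_fixed (hp : p.Prime) (hodd : p ≠ 2) (hm : m ≠ 0)
    [FiniteDimensional ℂ V] (ρ : Representation ℂ (SpecialLinearGroup (Fin 2) (ZMod (p ^ m))) V)
    [ρ.IsIrreducible] {v : V} (hv : ρ (upper 1) v = v) (hv0 : v ≠ 0) :
    finrank ℂ V ≤ p ^ m + p ^ (m - 1) := by
  have : NeZero (p ^ m) := ⟨pow_ne_zero _ hp.ne_zero⟩
  have hfix : ∀ w, w ∈ End.eigenspace (ρ (upper 1)) 1 → ∀ x, ρ (upper x) w = w := by
    intro w hw x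
    rw [End.mem_eigenspace_iff, one_smul] at hw
    simpa using map_upper_apply_of_fixed ρ hw x
  have := ZMod.isCyclic_units_of_prime_pow p hp hodd m
  obtain ⟨t₀, ht₀⟩ := IsCyclic.exists_monoid_generator (α := (ZMod (p ^ m))ˣ)
  obtain ⟨w, hw, hw0, c, hc⟩ := End.exists_apply_eq_smul_mem (ρ (torus t₀))
    (W := End.eigenspace (ρ (upper 1)) 1) (fun x hx => by
      rw [End.mem_eigenspace_iff, one_smul, ← End.mul_apply, ← map_mul]
      have h1 : upper 1 * torus t₀ =
          torus t₀ * upper (((t₀⁻¹ : (ZMod (p ^ m))ˣ) : ZMod (p ^ m)) *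
            ((t₀⁻¹ : (ZMod (p ^ m))ˣ) : ZMod (p ^ m))) := by
        rw [torus_mul_upper]
        congr 2
        linear_combination (-(t₀ * (t₀⁻¹ : (ZMod (p ^ m))ˣ) : ZMod (p ^ m)) - 1) * t₀.mul_inv
      rw [h1, map_mul, End.mul_apply, hfix x hx])
    ((Submodule.ne_bot_iff _).2 ⟨v, by simpa [End.mem_eigenspace_iff] using hv, hv0⟩)
  have htorus : ∀ t, ∃ c : ℂ, ρ (torus t) w = c • w := fun t => by
    obtain ⟨k, rfl⟩ := ht₀ t
    refine ⟨c ^ k, ?_⟩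
    simp only [torus_pow, map_pow]
    exact End.pow_apply_of_apply_eq_smul hc k
  let f : ZMod (p ^ m) ⊕ Fin (p ^ (m - 1)) → V := Sum.elim (fun y => ρ (lower y) w)
    (fun j => ρ (weyl * lower (p * ((j : ℕ) : ZMod (p ^ m)))) w)
  have hborel : ∀ k t x, ρ k w ∈ Set.range f →
      ρ (k * torus t * upper x) w ∈ Submodule.span ℂ (Set.range f) := by
    intro k t x hk
    obtain ⟨c, hc⟩ := htorus t
    rw [map_mul, map_mul, End.mul_apply, End.mul_apply, hfix w hw, hc, map_smul]
    exact Submodule.smul_mem _ _ (Submodule.subset_span hk)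
  have hspan : Submodule.span ℂ (Set.range f) = ⊤ := by
    rw [eq_top_iff, ← Representation.IsIrreducible.span_orbit_eq_top ρ hw0, Submodule.span_le]
    rintro _ ⟨g, rfl⟩
    have hdet := det_eq_one_fin_two g
    by_cases ha : IsUnit (g 0 0)
    · obtain ⟨a, ha⟩ := ha
      have haa := a.inv_mul
      have hg : g = lower (g 1 0 * (a⁻¹ : (ZMod (p ^ m))ˣ)) * torus a *
          upper (g 0 1 * (a⁻¹ : (ZMod (p ^ m))ˣ)) := by
        rw [← ha] at hdet
        apply ext_fin_two <;> simp only [mul_entry] <;> simp [← ha]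
        · linear_combination (-g 0 1) * haa
        · linear_combination (-g 1 1) * haa + (a⁻¹ : (ZMod (p ^ m))ˣ) * hdet
      rw [hg]
      exact hborel _ _ _ ⟨Sum.inl _, rfl⟩
    · obtain ⟨c, hc⟩ := (ZMod.isUnit_or_isUnit_of_mul_sub_mul_eq_one hp hm hdet).resolve_left ha
      have hna : ¬ IsUnit (-(g 0 0 * (c⁻¹ : (ZMod (p ^ m))ˣ))) := by
        rwa [IsUnit.neg_iff, Units.isUnit_mul_units]
      obtain ⟨j, hj, hja⟩ := ZMod.exists_eq_mul_of_not_isUnit hp hm hna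
      have hcc := c.inv_mul
      have hg : g = weyl * lower (-(g 0 0 * (c⁻¹ : (ZMod (p ^ m))ˣ))) * torus (-c) *
          upper (g 1 1 * (c⁻¹ : (ZMod (p ^ m))ˣ)) := by
        rw [← hc] at hdet
        apply ext_fin_two <;> simp only [mul_entry] <;> simp [← hc]
        · linear_combination (-(c⁻¹ : (ZMod (p ^ m))ˣ) : ZMod (p ^ m)) * hdet - g 0 1 * hcc
        · linear_combination (-g 1 1) * hcc
      rw [hg, hja]
      exact hborel _ _ _ ⟨Sum.inr ⟨j, hj⟩, rfl⟩
  have hcard := finrank_range_le_card (R := ℂ) f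
  rw [Set.finrank, hspan, finrank_top] at hcard
  simpa [ZMod.card] using hcard

/-- The elements of `SL₂` over a local ring, sorted by whether the upper left entry is a unit. -/
def ofSum {R : Type*} [CommRing R] :
    (Rˣ × R × R) ⊕ ({a : R // ¬ IsUnit a} × Rˣ × R) → SpecialLinearGroup (Fin 2) R
  | .inl (a, b, c) => ⟨!![a, b; c, (a⁻¹ : Rˣ) * (1 + b * c)], by
      rw [det_fin_two_of]
      linear_combination (1 + b * c) * a.mul_inv⟩
  | .inr (a, c, d) => ⟨!![a, (c⁻¹ : Rˣ) * (a * d - 1); c, d], by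
      rw [det_fin_two_of]
      linear_combination (1 - a * d) * c.inv_mul⟩

theorem bijective_ofSum {R : Type*} [CommRing R]
    (hR : ∀ a b c d : R, a * d - b * c = 1 → IsUnit a ∨ IsUnit c) :
    Function.Bijective (ofSum (R := R)) := by
  constructor
  · rintro (⟨a, b, c⟩ | ⟨⟨a, ha⟩, c, d⟩) (⟨a', b', c'⟩ | ⟨⟨a', ha'⟩, c', d'⟩) h
    all_goals
      have h00 := congrArg (fun g : SpecialLinearGroup (Fin 2) R => g 0 0) h
      have h01 := congrArg (fun g : SpecialLinearGroup (Fin 2) R => g 0 1) h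
      have h10 := congrArg (fun g : SpecialLinearGroup (Fin 2) R => g 1 0) h
      have h11 := congrArg (fun g : SpecialLinearGroup (Fin 2) R => g 1 1) h
      simp only [ofSum, of_apply, cons_val', cons_val_zero, cons_val_one, coe_mk] at h00 h01 h10 h11
    · simp [Units.ext h00, h01, h10]
    · exact absurd (h00 ▸ a.isUnit) ha'
    · exact absurd (h00 ▸ a'.isUnit) ha
    · simp [h00, Units.ext h10, h11]
  · intro g
    have hdet := det_eq_one_fin_two g
    by_cases ha : IsUnit (g 0 0)
    · obtain ⟨a, ha⟩ := ha
      refine ⟨Sum.inl (a, g 0 1, g 1 0), ?_⟩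
      apply ext_fin_two <;> simp [ofSum, ha]
      rw [← ha] at hdet
      linear_combination (-(a⁻¹ : Rˣ) : R) * hdet + g 1 1 * a.inv_mul
    · obtain ⟨c, hc⟩ := (hR _ _ _ _ hdet).resolve_left ha
      refine ⟨Sum.inr (⟨g 0 0, ha⟩, c, g 1 1), ?_⟩
      apply ext_fin_two <;> simp [ofSum, hc]
      rw [← hc] at hdet
      linear_combination ((c⁻¹ : Rˣ) : R) * hdet + g 0 1 * c.inv_mul

theorem card_fin_two_zmod_prime_pow (hp : p.Prime) (hm : m ≠ 0) :
    Nat.card (SpecialLinearGroup (Fin 2) (ZMod (p ^ m))) = p ^ (3 * m - 2) * (p ^ 2 - 1) := by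
  have : NeZero (p ^ m) := ⟨pow_ne_zero _ hp.ne_zero⟩
  have hU : Nat.card (ZMod (p ^ m))ˣ = p ^ (m - 1) * (p - 1) := by
    rw [Nat.card_eq_fintype_card, ZMod.card_units_eq_totient,
      Nat.totient_prime_pow hp (Nat.pos_of_ne_zero hm)]
  have hR : Nat.card (ZMod (p ^ m)) = p ^ m := Nat.card_zmod _
  have hN : Nat.card (ZMod (p ^ m))ˣ + Nat.card {a : ZMod (p ^ m) // ¬ IsUnit a} =
      Nat.card (ZMod (p ^ m)) := by
    rw [Nat.card_congr (Submonoid.unitsTypeEquivIsUnitSubmonoid (M := ZMod (p ^ m))).toEquiv,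
      ← Nat.card_congr (Equiv.sumCompl (IsUnit (M := ZMod (p ^ m)))), Nat.card_sum]
    rfl
  rw [← Nat.card_eq_of_bijective _ (bijective_ofSum fun _ _ _ _ h =>
    ZMod.isUnit_or_isUnit_of_mul_sub_mul_eq_one hp hm h)]
  simp only [Nat.card_sum, Nat.card_prod, hU, hR] at hN ⊢
  obtain ⟨k, rfl⟩ : ∃ k, m = k + 1 := ⟨m - 1, by lia⟩
  obtain ⟨r, rfl⟩ : ∃ r, p = r + 1 := ⟨p - 1, by have := hp.pos; lia⟩
  rw [show 3 * (k + 1) - 2 = 3 * k + 1 by lia, show (r + 1) ^ 2 - 1 = r * (r + 2) by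
    rw [show (r + 1) ^ 2 = r * (r + 2) + 1 by ring]; simp]
  simp only [Nat.add_sub_cancel] at hN ⊢
  have hN' : Nat.card {a : ZMod ((r + 1) ^ (k + 1)) // ¬ IsUnit a} = (r + 1) ^ k := by
    refine Nat.add_left_cancel (n := (r + 1) ^ k * r) (hN.trans ?_)
    ring
  rw [hN']
  ring

end Borel

section Unipotent

variable {R : Type*} [CommRing R] {q : R} {u : Rˣ}

theorem coe_inv_eq_one_sub (hq : q * q = 0) (hu : (u : R) = 1 + q) : ((u⁻¹ : Rˣ) : R) = 1 - q :=
  Units.inv_eq_of_mul_eq_one_right (by rw [hu]; linear_combination -hq)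

theorem upper_mul_lower_of_mul_eq_zero {y t : R} (h : y * t = 0) :
    upper y * lower t = lower t * upper y := by
  apply ext_fin_two <;> simp [mul_entry, h, mul_comm t y]

theorem torus_mul_lower_of_mul_eq_zero (hq : q * q = 0) (hu : (u : R) = 1 + q) {t : R}
    (ht : q * t = 0) : torus u * lower t = lower t * torus u := by
  apply ext_fin_two <;> simp only [mul_entry] <;> simp [coe_inv_eq_one_sub hq hu, hu]
  linear_combination -2 * ht

theorem torus_mul_upper_of_mul_self_eq_zero (hq : q * q = 0) (hu : (u : R) = 1 + q) (s : R) :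
    torus u * upper s = upper s * upper (2 * (s * q)) * torus u := by
  rw [torus_mul_upper, hu, ← upper_add]
  congr 2
  linear_combination s * hq

theorem upper_mul_lower_of_mul_eq (hq : q * q = 0) (hu : (u : R) = 1 + q) {s t : R}
    (hst : s * t = q) (ht : q * t = 0) :
    upper s * lower t = lower t * upper s * upper (s * q) * torus u := by
  rw [mul_assoc (lower t), ← upper_add]
  apply ext_fin_two <;> simp only [mul_entry] <;> simp [coe_inv_eq_one_sub hq hu, hu]
  · linear_combination hst
  · linear_combination s * hq
  · linear_combination -ht
  · linear_combination (q * q - 1) * hst + q * hq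

theorem coe_pow_eq_one_add (hq : q * q = 0) (hu : (u : R) = 1 + q) (n : ℕ) :
    ((u ^ n : Rˣ) : R) = 1 + n * q := by
  induction n with
  | zero => simp
  | succ n ih =>
    rw [pow_succ, Units.val_mul, ih, hu]
    push_cast
    linear_combination (n : R) * hq

theorem eq_upper_mul_lower_mul_torus_pow (hq : q * q = 0) (hu : (u : R) = 1 + q)
    {g : SpecialLinearGroup (Fin 2) R} {x : ℕ} {y z : R} (h00 : g 0 0 = 1 + x * q)
    (h01 : g 0 1 = y * q) (h10 : g 1 0 = z * q) (h11 : g 1 1 = 1 - x * q) :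
    g = upper (y * q) * lower (z * q) * torus u ^ x := by
  have hun := coe_pow_eq_one_add hq hu x
  have hun' := coe_inv_eq_one_sub (q := (x : R) * q) (by linear_combination (x : R) * x * hq) hun
  rw [← torus_pow]
  apply ext_fin_two
  · simp only [mul_entry]
    simp [hun, -Units.val_pow_eq_pow_val, h00]
    linear_combination (-y * z - y * z * x * q) * hq
  · simp only [mul_entry]
    simp [hun', -Units.val_pow_eq_pow_val, h01, -inv_pow]
    linear_combination y * x * hq
  · simp only [mul_entry]
    simp [hun, -Units.val_pow_eq_pow_val, h10]
    linear_combination -z * x * hq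
  · simp only [mul_entry]
    simp [hun', -Units.val_pow_eq_pow_val, h11, -inv_pow]

end Unipotent

section Descent

variable {p n : ℕ} [NeZero n] {V : Type*} [AddCommGroup V] [Module ℂ V] [FiniteDimensional ℂ V]
  (ρ : Representation ℂ (SpecialLinearGroup (Fin 2) (ZMod n)) V) {q r t : ZMod n}
  {u : (ZMod n)ˣ} {ζ : ℂ}

theorem exists_upper_fixed_of_mul (hp : p.Prime) (hq : q * q = 0) (hu : (u : ZMod n) = 1 + q)
    (hr : q = p * r) {s t : ZMod n} (hst : s * t = q) (ht : q * t = 0) (hpq : p * q = 0)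
    (hζ : ζ ^ p = 1) (hζ1 : ζ ≠ 1)
    {v : V} (hv0 : v ≠ 0) (hv : ρ (upper (p * s)) v = v) (hvu : ρ (torus u) v = ζ • v) :
    ∃ w : V, w ≠ 0 ∧ ρ (upper s) w = w ∧ ρ (torus u) w = ζ • w := by
  set W : Submodule ℂ V := End.eigenspace (ρ (upper (p * s))) 1 ⊓ End.eigenspace (ρ (torus u)) ζ
    with hWdef
  have hW : ∀ w, w ∈ W ↔ ρ (upper (p * s)) w = w ∧ ρ (torus u) w = ζ • w := by
    simp [hWdef]
  have hWs : ∀ w ∈ W, ∀ x, ρ (upper (x * (s * q))) w = w := fun w hw x => by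
    have := map_upper_apply_of_fixed ρ ((hW w).1 hw).1 (x * r)
    rwa [show x * r * (p * s) = x * (s * q) by rw [hr]; ring] at this
  have hUW : ∀ w ∈ W, ρ (upper s) w ∈ W := fun w hw => by
    rw [hW]
    constructor
    · rw [← End.mul_apply, ← map_mul, ← upper_add, add_comm, upper_add, map_mul, End.mul_apply,
        ((hW w).1 hw).1]
    · rw [← End.mul_apply, ← map_mul, torus_mul_upper_of_mul_self_eq_zero hq hu, map_mul, map_mul,
        End.mul_apply, End.mul_apply, ((hW w).1 hw).2, map_smul, map_smul, hWs w hw]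
  have hYW : ∀ w ∈ W, ρ (lower t) w ∈ W := fun w hw => by
    rw [hW]
    constructor
    · rw [← End.mul_apply, ← map_mul, upper_mul_lower_of_mul_eq_zero
        (by rw [mul_assoc, hst, hpq]), map_mul, End.mul_apply, ((hW w).1 hw).1]
    · rw [← End.mul_apply, ← map_mul, torus_mul_lower_of_mul_eq_zero hq hu ht, map_mul,
        End.mul_apply, ((hW w).1 hw).2, map_smul]
  obtain ⟨w, hwW, hw0, μ, hμ⟩ := End.exists_apply_eq_smul_mem (ρ (upper s)) hUW
    ((Submodule.ne_bot_iff _).2 ⟨v, (hW v).2 ⟨hv, hvu⟩, hv0⟩)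
  have hμp : μ ^ p = 1 := End.pow_eq_one_of_apply_eq_smul (T := ρ (upper s))
    (by rw [← map_pow, upper_pow, ((hW w).1 hwW).1]) hμ hw0
  have hprim : IsPrimitiveRoot ζ p :=
    IsPrimitiveRoot.iff_orderOf.2 (orderOf_eq_prime hζ hζ1 (hp := ⟨hp⟩))
  have hshift : ∀ j : ℕ, ρ (lower t ^ j) w ∈ W ∧
      ρ (upper s) (ρ (lower t ^ j) w) = (ζ ^ j * μ) • ρ (lower t ^ j) w := fun j => by
    induction j with
    | zero => simpa using ⟨hwW, hμ⟩
    | succ j ih =>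
      rw [pow_succ', map_mul, End.mul_apply]
      refine ⟨hYW _ ih.1, ?_⟩
      rw [← End.mul_apply, ← map_mul, upper_mul_lower_of_mul_eq hq hu hst ht, map_mul, map_mul,
        map_mul, End.mul_apply, End.mul_apply, End.mul_apply, ((hW _).1 ih.1).2, map_smul,
        map_smul, map_smul, ← one_mul (s * q), hWs _ ih.1, ih.2, map_smul, smul_smul]
      ring_nf
  have : NeZero p := ⟨hp.ne_zero⟩
  obtain ⟨i, hi, rfl⟩ := hprim.eq_pow_of_pow_eq_one hμp
  refine ⟨ρ (lower t ^ (p - i)) w, ρ.apply_ne_zero _ hw0, ?_, ((hW _).1 (hshift _).1).2⟩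
  rw [(hshift _).2, ← pow_add, Nat.sub_add_cancel hi.le, hζ, one_smul]

theorem exists_upper_one_fixed (hp : p.Prime) {m : ℕ} (hm : 2 ≤ m)
    (ρ : Representation ℂ (SpecialLinearGroup (Fin 2) (ZMod (p ^ m))) V) {u : (ZMod (p ^ m))ˣ}
    (hu : (u : ZMod (p ^ m)) = 1 + (p : ZMod (p ^ m)) ^ (m - 1)) (hζ : ζ ^ p = 1) (hζ1 : ζ ≠ 1)
    {v : V} (hv0 : v ≠ 0) (hv : ρ (upper ((p : ZMod (p ^ m)) ^ (m - 1))) v = v)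
    (hvu : ρ (torus u) v = ζ • v) : ∃ w : V, w ≠ 0 ∧ ρ (upper 1) w = w := by
  have : NeZero (p ^ m) := ⟨pow_ne_zero _ hp.ne_zero⟩
  have hpm : (p : ZMod (p ^ m)) ^ m = 0 := by rw [← Nat.cast_pow, ZMod.natCast_self]
  have hstep : ∀ k ≤ m - 1, ∃ w : V, w ≠ 0 ∧ ρ (upper ((p : ZMod (p ^ m)) ^ (m - 1 - k))) w = w ∧
      ρ (torus u) w = ζ • w := by
    intro k hk
    induction k with
    | zero => exact ⟨v, hv0, hv, hvu⟩
    | succ k ih =>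
      obtain ⟨w, hw0, hw, hwu⟩ := ih (by lia)
      refine exists_upper_fixed_of_mul ρ (r := (p : ZMod (p ^ m)) ^ (m - 2))
        (t := (p : ZMod (p ^ m)) ^ (k + 1)) hp (ZMod.natCast_pow_mul_self_eq_zero hm) hu ?_ ?_ ?_ ?_
        hζ hζ1 hw0 ?_ hwu
      · rw [← pow_succ']
        congr 1
        lia
      · rw [← pow_add]
        congr 1
        lia
      · rw [← pow_add, show m - 1 + (k + 1) = m + k by lia, pow_add, hpm, zero_mul]
      · rw [← pow_succ', show m - 1 + 1 = m by lia, hpm]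
      · rwa [← pow_succ', show m - 1 - (k + 1) + 1 = m - 1 - k by lia]
  obtain ⟨w, hw0, hw, -⟩ := hstep (m - 1) le_rfl
  exact ⟨w, hw0, by simpa using hw⟩

end Descent

section Congruence

variable {n : ℕ} [NeZero n] {V : Type*} [AddCommGroup V] [Module ℂ V]
  (ρ : Representation ℂ (SpecialLinearGroup (Fin 2) (ZMod n)) V) {q : ZMod n}
  {u : (ZMod n)ˣ} {η : ℂ} {v : V}

theorem apply_eq_pow_smul (hq : q * q = 0) (hu : (u : ZMod n) = 1 + q)
    (hE : ρ (upper q) v = v) (hF : ρ (lower q) v = η • v) (hH : ρ (torus u) v = v)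
    {g : SpecialLinearGroup (Fin 2) (ZMod n)} {x y z : ZMod n} (h00 : g 0 0 = 1 + x * q)
    (h01 : g 0 1 = y * q) (h10 : g 1 0 = z * q) (h11 : g 1 1 = 1 - x * q) :
    ρ g v = η ^ z.val • v := by
  have h1 := End.pow_apply_of_apply_eq_smul (T := ρ (torus u)) (μ := 1) (by simpa using hH) x.val
  have h2 := End.pow_apply_of_apply_eq_smul hF z.val
  rw [← map_pow, lower_pow, ZMod.natCast_zmod_val] at h2
  rw [eq_upper_mul_lower_mul_torus_pow hq hu (x := x.val) (y := y) (z := z)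
    (by rw [h00, ZMod.natCast_zmod_val]) h01 h10 (by rw [h11, ZMod.natCast_zmod_val]),
    map_mul, map_mul, End.mul_apply, End.mul_apply, map_pow, h1, one_pow, one_smul, h2, map_smul,
    map_upper_apply_of_fixed ρ hE]

theorem upper_apply_eq_pow_smul (hq : q * q = 0) (hu : (u : ZMod n) = 1 + q)
    (hE : ρ (upper q) v = v) (hF : ρ (lower q) v = η • v) (hH : ρ (torus u) v = v)
    (g : SpecialLinearGroup (Fin 2) (ZMod n)) :
    ρ (upper q) (ρ g v) = η ^ (-(g 1 0 ^ 2)).val • ρ g v := by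
  have hdet := det_eq_one_fin_two g
  have h1 : ρ (g⁻¹ * upper q * g) v = η ^ (-(g 1 0 ^ 2)).val • v := by
    refine apply_eq_pow_smul ρ (x := g 1 0 * g 1 1) (y := g 1 1 ^ 2) hq hu hE hF hH ?_ ?_ ?_ ?_
    all_goals
      simp only [mul_entry]
      simp [adjugate_fin_two]
      first | linear_combination hdet | ring1
  rw [← map_smul, ← h1, ← End.mul_apply, ← End.mul_apply, ← map_mul, ← map_mul]
  congr 2
  group

end Congruence

section Reduction

variable {p m : ℕ}

theorem map_castHom_surjective (hp : p.Prime) (hm : m ≠ 0) :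
    Function.Surjective (SpecialLinearGroup.map (n := Fin 2)
      (ZMod.castHom (pow_dvd_pow p (Nat.le_add_right m 1)) (ZMod (p ^ m)))) := by
  have : NeZero (p ^ (m + 1)) := ⟨pow_ne_zero _ hp.ne_zero⟩
  set π := ZMod.castHom (pow_dvd_pow p (Nat.le_add_right m 1)) (ZMod (p ^ m))
  have hπ : Function.Surjective π := ZMod.ringHom_surjective π
  have hπe : ∀ g i j, (SpecialLinearGroup.map (n := Fin 2) π g) i j = π (g i j) :=
    fun _ _ _ => rfl
  have hπu : ∀ b : (ZMod (p ^ m))ˣ, ∃ a : (ZMod (p ^ (m + 1)))ˣ, π a = b ∧ π (a⁻¹ : Units _) =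
      (b⁻¹ : Units _) := fun b => by
    obtain ⟨a, rfl⟩ := ZMod.unitsMap_surjective (pow_dvd_pow p (Nat.le_add_right m 1)) b
    exact ⟨a, rfl, by rw [← map_inv]; rfl⟩
  intro g
  obtain ⟨x, rfl⟩ := (bijective_ofSum fun _ _ _ _ h =>
    ZMod.isUnit_or_isUnit_of_mul_sub_mul_eq_one hp hm h).2 g
  rcases x with ⟨a, b, c⟩ | ⟨⟨a, ha⟩, c, d⟩
  · obtain ⟨a, ha, ha'⟩ := hπu a
    obtain ⟨b, rfl⟩ := hπ b
    obtain ⟨c, rfl⟩ := hπ c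
    refine ⟨ofSum (.inl (a, b, c)), ?_⟩
    apply ext_fin_two <;> (rw [hπe]; simp [ofSum, ha, ha'])
  · obtain ⟨a, rfl⟩ := hπ a
    obtain ⟨c, hc, hc'⟩ := hπu c
    obtain ⟨d, rfl⟩ := hπ d
    refine ⟨ofSum (.inr (⟨a, fun h => ha (h.map π)⟩, c, d)), ?_⟩
    apply ext_fin_two <;> (rw [hπe]; simp [ofSum, hc, hc'])

variable {V : Type*} [AddCommGroup V] [Module ℂ V]

/-- An irreducible representation with a nonzero vector fixed by the generators of the last
congruence subgroup factors through the reduction map. -/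
theorem exists_factor_of_fixed (hp : p.Prime) (hm : m ≠ 0)
    (ρ : Representation ℂ (SpecialLinearGroup (Fin 2) (ZMod (p ^ (m + 1)))) V) [ρ.IsIrreducible]
    {u : (ZMod (p ^ (m + 1)))ˣ} (hu : (u : ZMod (p ^ (m + 1))) = 1 + (p : ZMod (p ^ (m + 1))) ^ m)
    {v : V} (hv0 : v ≠ 0) (hE : ρ (upper ((p : ZMod (p ^ (m + 1))) ^ m)) v = v)
    (hF : ρ (lower ((p : ZMod (p ^ (m + 1))) ^ m)) v = v) (hH : ρ (torus u) v = v) :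
    ∃ σ : Representation ℂ (SpecialLinearGroup (Fin 2) (ZMod (p ^ m))) V, σ.IsIrreducible := by
  have : NeZero (p ^ (m + 1)) := ⟨pow_ne_zero _ hp.ne_zero⟩
  set q := (p : ZMod (p ^ (m + 1))) ^ m with hqdef
  have hq : q * q = 0 := ZMod.natCast_pow_mul_self_eq_zero (m := m + 1) (by lia)
  set f := ZMod.castHom (pow_dvd_pow p (Nat.le_add_right m 1)) (ZMod (p ^ m))
  have hf : ∀ a, f a = 0 → ∃ x, a = x * q := fun a ha => by
    rw [← ZMod.natCast_zmod_val a, map_natCast, ZMod.natCast_eq_zero_iff] at ha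
    obtain ⟨j, hj⟩ := ha
    refine ⟨j, ?_⟩
    rw [← ZMod.natCast_zmod_val a, hj]
    push_cast
    ring
  set π := SpecialLinearGroup.map (n := Fin 2) f
  have hπ : Function.Surjective π := map_castHom_surjective hp hm
  have hπe : ∀ g i j, (π g) i j = f (g i j) := fun _ _ _ => rfl
  have hfix : ∀ g, π g = 1 → ρ g v = v := fun g hg => by
    obtain ⟨x, hx⟩ := hf (g 0 0 - 1) (by rw [map_sub, ← hπe, hg]; simp)
    obtain ⟨w, hw⟩ := hf (g 1 1 - 1) (by rw [map_sub, ← hπe, hg]; simp)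
    obtain ⟨y, hy⟩ := hf (g 0 1) (by rw [← hπe, hg]; simp)
    obtain ⟨z, hz⟩ := hf (g 1 0) (by rw [← hπe, hg]; simp)
    have hdet := det_eq_one_fin_two g
    have h1 := apply_eq_pow_smul ρ (η := 1) (g := g) (x := x) hq hu hE (by rwa [one_smul]) hH
      (by linear_combination hx) hy hz (by
        rw [hy, hz] at hdet
        linear_combination hdet - g 1 1 * hx - x * q * hw + (y * z - x * w) * hq)
    simpa using h1
  have htriv : ∀ g, π g = 1 → ρ g = 1 := fun g hg => by
    let W : Submodule ℂ V := ⨅ k : π.ker, End.eigenspace (ρ k) 1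
    have hW : ∀ w, w ∈ W ↔ ∀ k, π k = 1 → ρ k w = w := by
      simp [W, MonoidHom.mem_ker]
    have htop := Representation.IsIrreducible.submodule_eq_top ρ W (fun g w hw => by
      rw [hW] at hw ⊢
      intro k hk
      have h1 := hw (g⁻¹ * k * g) (by simp [hk])
      nth_rw 2 [← h1]
      rw [← End.mul_apply, ← End.mul_apply, ← map_mul, ← map_mul]
      congr 2
      group) ((hW v).2 hfix) hv0
    ext w
    exact (hW w).1 (htop ▸ Submodule.mem_top) g hg
  have heq : ∀ g h, π g = π h → ρ g = ρ h := fun g h hgh => by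
    have h1 := htriv (g * h⁻¹) (by rw [map_mul, hgh, ← map_mul, mul_inv_cancel, map_one])
    rw [← one_mul (ρ h), ← h1, ← map_mul, inv_mul_cancel_right]
  let σ : Representation ℂ (SpecialLinearGroup (Fin 2) (ZMod (p ^ m))) V :=
    { toFun := fun g => ρ (Function.surjInv hπ g)
      map_one' := by
        rw [← map_one ρ]
        exact heq _ _ ((Function.surjInv_eq hπ 1).trans (map_one π).symm)
      map_mul' := fun g h => by
        rw [← map_mul]
        exact heq _ _ (by simp only [map_mul, Function.surjInv_eq]) }
  have hσ : ∀ g, σ (π g) = ρ g := fun g => heq _ _ (Function.surjInv_eq _ _)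
  have := Representation.IsIrreducible.nontrivial ρ
  refine ⟨σ, Representation.IsIrreducible.of_forall_submodule fun U hU => ?_⟩
  by_contra! hne
  obtain ⟨w, hw, hw0⟩ := (Submodule.ne_bot_iff U).1 hne.1
  exact hne.2 (Representation.IsIrreducible.submodule_eq_top ρ U
    (fun g x hx => hσ g ▸ hU (π g) x hx) hw hw0)

end Reduction

section Bound

variable {p : ℕ} {V : Type*} [AddCommGroup V] [Module ℂ V]

theorem finrank_eigenspace_upper_le_finrank_eigenspace_lower {n : ℕ} [FiniteDimensional ℂ V]
    (ρ : Representation ℂ (SpecialLinearGroup (Fin 2) (ZMod n)) V) (x : ZMod n) :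
    finrank ℂ (End.eigenspace (ρ (upper x)) 1) ≤ finrank ℂ (End.eigenspace (ρ (lower x)) 1) := by
  have hmem : ∀ v ∈ End.eigenspace (ρ (upper x)) 1,
      ρ weyl v ∈ End.eigenspace (ρ (lower x)) 1 := fun v hv => by
    rw [End.mem_eigenspace_iff, one_smul] at hv ⊢
    have h1 : lower x * weyl * upper x = weyl := by
      apply ext_fin_two <;> simp [mul_entry]
    nth_rw 1 [← hv]
    rw [← End.mul_apply, ← End.mul_apply, ← map_mul, ← map_mul, h1]
  refine LinearMap.finrank_le_finrank_of_injective (f := (ρ weyl).restrict hmem) ?_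
  rw [injective_iff_map_eq_zero]
  intro v hv
  by_contra hv0
  exact ρ.apply_ne_zero weyl (v := (v : V)) (by simpa using hv0) (congrArg Subtype.val hv)

/-- The eigenvalues of the upper unipotent generator which are nondegenerate on the last
congruence subgroup. -/
noncomputable def primitiveSpectrum {m : ℕ}
    (ρ : Representation ℂ (SpecialLinearGroup (Fin 2) (ZMod (p ^ m))) V) : Finset ℂ :=
  open Classical in (primitiveRoots (p ^ m) ℂ).filter (End.HasEigenvalue (ρ (upper 1)))

theorem finrank_le_add_card_primitiveSpectrum (hp : p.Prime) {m : ℕ} [FiniteDimensional ℂ V]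
    (ρ : Representation ℂ (SpecialLinearGroup (Fin 2) (ZMod (p ^ (m + 1)))) V)
    [ρ.IsIrreducible] :
    finrank ℂ V ≤ finrank ℂ (End.eigenspace (ρ (upper ((p : ZMod (p ^ (m + 1))) ^ m))) 1) +
      (primitiveSpectrum ρ).card := by
  have : NeZero (p ^ (m + 1)) := ⟨pow_ne_zero _ hp.ne_zero⟩
  have : Fact p.Prime := ⟨hp⟩
  have hT : ρ (upper 1) ^ p ^ (m + 1) = 1 := by
    rw [← map_pow, upper_pow, ZMod.natCast_self, zero_mul, upper_zero, map_one]
  have hE : ρ (upper ((p : ZMod (p ^ (m + 1))) ^ m)) = ρ (upper 1) ^ p ^ m := by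
    rw [← map_pow, upper_pow, mul_one, Nat.cast_pow]
  rw [hE]
  refine End.finrank_le_finrank_eigenspace_pow_add_card (NeZero.ne (p ^ (m + 1))) hT _
    (fun μ hμ hμ1 => ?_) (fun μ hμ => ?_)
  · obtain ⟨v, hv⟩ := hμ.exists_hasEigenvector
    have h1 := End.pow_eq_one_of_apply_eq_smul (n := p ^ (m + 1)) (by simp [hT])
      hv.apply_eq_smul hv.2
    simp only [primitiveSpectrum, Finset.mem_filter]
    exact ⟨(mem_primitiveRoots (NeZero.pos _)).2
      (IsPrimitiveRoot.iff_orderOf.2 (orderOf_eq_prime_pow hμ1 h1)), hμ⟩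
  · simp only [primitiveSpectrum, Finset.mem_filter] at hμ
    exact finrank_eigenspace_upper_le_one ρ ((mem_primitiveRoots (NeZero.pos _)).1 hμ.1)

theorem finrank_le_of_eigenspace_eq_bot (hp : p.Prime) {m : ℕ} [FiniteDimensional ℂ V]
    (ρ : Representation ℂ (SpecialLinearGroup (Fin 2) (ZMod (p ^ (m + 1)))) V)
    [ρ.IsIrreducible]
    (h : End.eigenspace (ρ (upper ((p : ZMod (p ^ (m + 1))) ^ m))) 1 = ⊥) :
    finrank ℂ V ≤ p ^ (m + 1) := by
  classical
  refine (finrank_le_add_card_primitiveSpectrum hp ρ).trans ?_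
  rw [h, finrank_bot, zero_add]
  refine (Finset.card_filter_le _ _).trans ?_
  rw [Complex.card_primitiveRoots]
  exact Nat.totient_le _

/-- If the last congruence subgroup has a vector of nilpotent type, then at most half of the
nondegenerate characters of the upper unipotent subgroup occur. -/
theorem two_mul_card_primitiveSpectrum_le (hp : p.Prime) (hodd : p ≠ 2) {m : ℕ} (hm : m ≠ 0)
    (ρ : Representation ℂ (SpecialLinearGroup (Fin 2) (ZMod (p ^ (m + 1)))) V) [ρ.IsIrreducible]
    {u : (ZMod (p ^ (m + 1)))ˣ} (hu : (u : ZMod (p ^ (m + 1))) = 1 + (p : ZMod (p ^ (m + 1))) ^ m)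
    {v : V} (hv0 : v ≠ 0) {η : ℂ} (hη : IsPrimitiveRoot η p)
    (hE : ρ (upper ((p : ZMod (p ^ (m + 1))) ^ m)) v = v)
    (hF : ρ (lower ((p : ZMod (p ^ (m + 1))) ^ m)) v = η • v) (hH : ρ (torus u) v = v) :
    2 * (primitiveSpectrum ρ).card ≤ p ^ m * (p - 1) := by
  classical
  have : NeZero (p ^ (m + 1)) := ⟨pow_ne_zero _ hp.ne_zero⟩
  have : Fact p.Prime := ⟨hp⟩
  set q := (p : ZMod (p ^ (m + 1))) ^ m with hqdef
  have hq : q * q = 0 := ZMod.natCast_pow_mul_self_eq_zero (m := m + 1) (by lia)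
  have hprim : ∀ μ ∈ primitiveSpectrum ρ, IsPrimitiveRoot μ (p ^ (m + 1)) := fun μ hμ => by
    simp only [primitiveSpectrum, Finset.mem_filter] at hμ
    exact (mem_primitiveRoots (NeZero.pos _)).1 hμ.1
  have hval : ∀ μ ∈ primitiveSpectrum ρ, ∃ (j : ℕ) (c : ZMod p), (j : ZMod p) = -c ^ 2 ∧
      c ≠ 0 ∧ μ ^ p ^ m = η ^ j := fun μ hμ => by
    have hμ1 : μ ^ p ^ m ≠ 1 := (hprim μ hμ).pow_ne_one_of_pos_of_lt
      (pow_ne_zero _ hp.ne_zero) (Nat.pow_lt_pow_right hp.one_lt (by lia))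
    simp only [primitiveSpectrum, Finset.mem_filter] at hμ
    obtain ⟨w, hw⟩ := hμ.2.exists_hasEigenvector
    have h1 := End.pow_apply_of_apply_eq_smul hw.apply_eq_smul (p ^ m)
    rw [← map_pow, upper_pow, mul_one, Nat.cast_pow, ← hqdef] at h1
    obtain ⟨g, hg⟩ := End.exists_eq_of_hasEigenvalue_of_span_eq_top
      (Representation.IsIrreducible.span_orbit_eq_top ρ hv0)
      (upper_apply_eq_pow_smul ρ hq hu hE hF hH)
      (End.hasEigenvalue_of_hasEigenvector
        (End.hasEigenvector_iff.2 ⟨End.mem_eigenspace_iff.2 h1, hw.2⟩))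
    set f := ZMod.castHom (dvd_pow_self p m.succ_ne_zero) (ZMod p)
    have hj : ((-(g 1 0 ^ 2)).val : ZMod p) = -(f (g 1 0)) ^ 2 := by
      rw [← map_pow, ← map_neg, ← map_natCast f, ZMod.natCast_zmod_val]
    refine ⟨(-(g 1 0 ^ 2)).val, f (g 1 0), hj, fun hc => hμ1 ?_, hg.symm⟩
    rw [hc, zero_pow two_ne_zero, neg_zero, ZMod.natCast_eq_zero_iff] at hj
    rw [← hg, hη.pow_eq_one_iff_dvd]
    exact hj
  obtain ⟨γ, hγ⟩ := FiniteField.exists_nonsquare (F := ZMod p) (by rwa [ZMod.ringChar_zmod_n])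
  have hγ0 : γ ≠ 0 := fun h => hγ (h ▸ IsSquare.zero)
  have hcop : γ.val.Coprime (p ^ (m + 1)) := Nat.Coprime.pow_right _ <| Nat.Coprime.symm <|
    hp.coprime_iff_not_dvd.2 fun h => hγ0 <| by
      rwa [← ZMod.natCast_eq_zero_iff, ZMod.natCast_zmod_val] at h
  have hinj : Set.InjOn (fun μ : ℂ => μ ^ γ.val) (primitiveSpectrum ρ) := fun μ hμ ν hν h => by
    have hν0 : ν ≠ 0 := (hprim ν hν).ne_zero (NeZero.ne _)
    have h1 : (μ / ν) ^ γ.val.gcd (p ^ (m + 1)) = 1 := pow_gcd_eq_one.2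
      ⟨by rw [div_pow, show μ ^ γ.val = ν ^ γ.val from h, div_self (pow_ne_zero _ hν0)],
        by rw [div_pow, (hprim μ hμ).pow_eq_one, (hprim ν hν).pow_eq_one, div_one]⟩
    rw [hcop.gcd_eq_one, pow_one] at h1
    exact (div_eq_one_iff_eq hν0).1 h1
  have hdisj : Disjoint (primitiveSpectrum ρ)
      ((primitiveSpectrum ρ).image fun μ => μ ^ γ.val) := by
    rw [Finset.disjoint_left]
    intro μ hμ hμ'
    obtain ⟨ν, hν, rfl⟩ := Finset.mem_image.1 hμ'
    obtain ⟨i, b, hi, hb, hbi⟩ := hval _ hμ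
    obtain ⟨j, c, hj, hc, hcj⟩ := hval ν hν
    rw [← pow_mul, mul_comm, pow_mul, hcj, ← pow_mul] at hbi
    have h1 := hη.natCast_eq_of_pow_eq hp.ne_zero hbi
    rw [Nat.cast_mul, ZMod.natCast_zmod_val, hi, hj] at h1
    refine hγ ⟨b / c, ?_⟩
    field_simp
    linear_combination -h1
  rw [two_mul]
  nth_rw 2 [← Finset.card_image_of_injOn hinj]
  rw [← Finset.card_union_of_disjoint hdisj]
  refine (Finset.card_le_card (t := primitiveRoots (p ^ (m + 1)) ℂ) fun μ hμ => ?_).trans ?_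
  · rw [mem_primitiveRoots (NeZero.pos _)]
    rcases Finset.mem_union.1 hμ with h | h
    · exact hprim μ h
    · obtain ⟨ν, hν, rfl⟩ := Finset.mem_image.1 h
      exact (hprim ν hν).pow_of_coprime _ hcop
  · rw [Complex.card_primitiveRoots, Nat.totient_prime_pow_succ hp]

/-- An irreducible representation of `SL₂(ℤ/p^(m+1)ℤ)` has dimension at most `p^(m+1) + p^m`. -/
theorem finrank_le_prime_pow_add (hp : p.Prime) (hodd : p ≠ 2) [FiniteDimensional ℂ V] (m : ℕ)
    (ρ : Representation ℂ (SpecialLinearGroup (Fin 2) (ZMod (p ^ (m + 1)))) V)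
    [ρ.IsIrreducible] : finrank ℂ V ≤ p ^ (m + 1) + p ^ m := by
  induction m with
  | zero =>
    by_cases hbot : End.eigenspace (ρ (upper ((p : ZMod (p ^ (0 + 1))) ^ 0))) 1 = ⊥
    · exact (finrank_le_of_eigenspace_eq_bot hp ρ hbot).trans (Nat.le_add_right _ _)
    obtain ⟨v, hv, hv0⟩ := (Submodule.ne_bot_iff _).1 hbot
    rw [End.mem_eigenspace_iff, one_smul, pow_zero] at hv
    exact finrank_le_of_upper_fixed hp hodd one_ne_zero ρ hv hv0
  | succ m ih =>
    have : NeZero (p ^ (m + 1 + 1)) := ⟨pow_ne_zero _ hp.ne_zero⟩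
    set q := (p : ZMod (p ^ (m + 1 + 1))) ^ (m + 1) with hqdef
    set W := End.eigenspace (ρ (upper q)) 1 with hWdef
    by_cases hbot : W = ⊥
    · exact (finrank_le_of_eigenspace_eq_bot hp ρ hbot).trans (Nat.le_add_right _ _)
    have hq : q * q = 0 := ZMod.natCast_pow_mul_self_eq_zero (m := m + 1 + 1) (by lia)
    have hpq : (p : ZMod (p ^ (m + 1 + 1))) * q = 0 := by
      rw [hqdef, ← pow_succ', ← Nat.cast_pow, ZMod.natCast_self]
    let u : (ZMod (p ^ (m + 1 + 1)))ˣ :=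
      ⟨1 + q, 1 - q, by linear_combination -hq, by linear_combination -hq⟩
    have hu : (u : ZMod (p ^ (m + 1 + 1))) = 1 + q := rfl
    have hW : ∀ w, w ∈ W ↔ ρ (upper q) w = w := by simp [hWdef]
    have hWH : ∀ w ∈ W, ρ (torus u) w ∈ W := fun w hw => by
      rw [hW] at hw ⊢
      have h1 := torus_mul_upper_of_mul_self_eq_zero hq hu q
      rw [hq, mul_zero, upper_zero, mul_one] at h1
      rw [← End.mul_apply, ← map_mul, ← h1, map_mul, End.mul_apply, hw]
    have hWF : ∀ w ∈ W, ρ (lower q) w ∈ W := fun w hw => by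
      rw [hW] at hw ⊢
      rw [← End.mul_apply, ← map_mul, upper_mul_lower_of_mul_eq_zero hq, map_mul, End.mul_apply,
        hw]
    have hup : ρ (torus u) ^ p = 1 := by
      rw [← map_pow, ← torus_pow, show u ^ p = 1 from
        Units.ext (by rw [coe_pow_eq_one_add hq hu, hpq, add_zero, Units.val_one]), torus_one,
        map_one]
    by_cases hreg : ∀ w ∈ W, w ≠ 0 → ∀ μ : ℂ, ρ (torus u) w = μ • w → μ = 1
    swap
    · push Not at hreg
      obtain ⟨w, hw, hw0, μ, hμ, hμ1⟩ := hreg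
      obtain ⟨w', hw0', hw'⟩ := exists_upper_one_fixed hp (by lia) ρ hu
        (End.pow_eq_one_of_apply_eq_smul (by simp [hup]) hμ hw0) hμ1 hw0 ((hW w).1 hw) hμ
      exact finrank_le_of_upper_fixed hp hodd (by lia) ρ hw' hw0'
    have hH : ∀ w ∈ W, ρ (torus u) w = w := fun w hw =>
      End.apply_eq_self_of_forall_eigenvalue_eq_one hp.ne_zero hup hWH hreg hw
    by_cases hfix : ∃ w ∈ W, w ≠ 0 ∧ ρ (lower q) w = w
    · obtain ⟨w, hw, hw0, hFw⟩ := hfix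
      obtain ⟨σ, hσ⟩ := exists_factor_of_fixed hp (Nat.add_one_ne_zero m) ρ hu hw0 ((hW w).1 hw) hFw
        (hH w hw)
      exact (ih σ).trans (add_le_add (Nat.pow_le_pow_right hp.pos (by lia))
        (Nat.pow_le_pow_right hp.pos (by lia)))
    · push Not at hfix
      obtain ⟨w, hw, hw0, η, hη⟩ := End.exists_apply_eq_smul_mem (ρ (lower q)) hWF hbot
      have hη1 : η ≠ 1 := fun h => hfix w hw hw0 (by rw [hη, h, one_smul])
      have hηp : η ^ p = 1 := End.pow_eq_one_of_apply_eq_smul (T := ρ (lower q))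
        (by rw [← map_pow, lower_pow, hpq, lower_zero, map_one, End.one_apply]) hη hw0
      have h2 := two_mul_card_primitiveSpectrum_le hp hodd (Nat.add_one_ne_zero m) ρ hu hw0
        (IsPrimitiveRoot.iff_orderOf.2 (orderOf_eq_prime hηp hη1 (hp := ⟨hp⟩))) ((hW w).1 hw) hη
        (hH w hw)
      have hdisj : Disjoint W (End.eigenspace (ρ (lower q)) 1) := by
        rw [Submodule.disjoint_def]
        intro x hx hx'
        rw [End.mem_eigenspace_iff, one_smul] at hx'
        by_contra hx0
        exact hfix x hx hx0 hx'
      have h3 := Submodule.finrank_add_finrank_le_of_disjoint hdisj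
      have h4 := finrank_eigenspace_upper_le_finrank_eigenspace_lower ρ q
      have h5 := finrank_le_add_card_primitiveSpectrum hp ρ
      have h6 : p ^ (m + 1) * (p - 1) ≤ p ^ (m + 1 + 1) :=
        Nat.mul_le_mul_left _ (Nat.sub_le p 1)
      rw [← hWdef] at h4 h5
      linarith [Nat.zero_le (p ^ (m + 1))]

end Bound

end Matrix.SpecialLinearGroup

/-- For `p` an odd prime and `m ≥ 2`, the group `SL₂(ℤ/p^mℤ)` has order
`p^{3m-2}(p²-1)`, and the dimension of any finite-dimensional irreducible complex
representation of `SL₂(ℤ/p^mℤ)` divides the group order `p^{3m-2}(p²-1)` and is at most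
`p^m(1 + 1/p)`. -/
theorem sl2_irreducible_dimension_bound
    (p m : ℕ) (hp : p.Prime) (hodd : p ≠ 2) (hm : 2 ≤ m)
    {V : Type*} [AddCommGroup V] [Module ℂ V] [FiniteDimensional ℂ V] [Nontrivial V]
    (ρ : Matrix.SpecialLinearGroup (Fin 2) (ZMod (p ^ m)) →* (V →ₗ[ℂ] V))
    (hirr : ∀ U : Submodule ℂ V,
      (∀ g : Matrix.SpecialLinearGroup (Fin 2) (ZMod (p ^ m)), ∀ x ∈ U, ρ g x ∈ U) →
      U = ⊥ ∨ U = ⊤) :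
    Nat.card (Matrix.SpecialLinearGroup (Fin 2) (ZMod (p ^ m))) = p ^ (3 * m - 2) * (p ^ 2 - 1) ∧
    Module.finrank ℂ V ∣ p ^ (3 * m - 2) * (p ^ 2 - 1) ∧
    (Module.finrank ℂ V : ℝ) ≤ (p : ℝ) ^ m * (1 + 1 / (p : ℝ)) := by
  have : NeZero (p ^ m) := ⟨pow_ne_zero _ hp.ne_zero⟩
  let σ : Representation ℂ (Matrix.SpecialLinearGroup (Fin 2) (ZMod (p ^ m))) V := ρ
  have hσ : σ.IsIrreducible :=
    Representation.IsIrreducible.of_forall_submodule hirr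
  have hcard := Matrix.SpecialLinearGroup.card_fin_two_zmod_prime_pow hp (m := m) (by lia)
  refine ⟨hcard, hcard ▸ hσ.finrank_dvd_card σ, ?_⟩
  obtain ⟨k, rfl⟩ : ∃ k, m = k + 1 := ⟨m - 1, by lia⟩
  have hle := Matrix.SpecialLinearGroup.finrank_le_prime_pow_add hp hodd k σ
  have hp0 : (p : ℝ) ≠ 0 := by exact_mod_cast hp.ne_zero
  have heq : (p : ℝ) ^ (k + 1) * (1 + 1 / (p : ℝ)) = p ^ (k + 1) + p ^ k := by
    field_simp
    ring
  rw [heq]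
  exact_mod_cast hle
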